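/- Let A be a proper assignment set for a closed walk W in the brickwall 𝓑, suppose {0, y} ∈ A with n(y) = 0, and set W' = W_{0,y} ∘ H_{y,0} and A' = A \ {{0,y}}. Then the number of elementary cycles of (W, A) is exactly one more than the number of elementary cycles of (W', A'). -/

import Mathlib

open scoped Classical

namespace Hex

/-- Adjacency in the brickwall `𝓑`: vertex `(i,j)` is `b_{i,j}`.
Horizontal edges `b_{i,j} b_{i+1,j}` for all `i,j`, and vertical edges
`b_{i,j} b_{i+1,j+1}` for odd `i`. -/
def bwAdj (u v : ℤ × ℤ) : Prop :=
  (u.2 = v.2 ∧ (v.1 = u.1 + 1 ∨ u.1 = v.1 + 1)) ∨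
  (Odd u.1 ∧ v.1 = u.1 + 1 ∧ v.2 = u.2 + 1) ∨
  (Odd v.1 ∧ u.1 = v.1 + 1 ∧ u.2 = v.2 + 1)

/-- A closed walk of length `k` in the brickwall, represented by a `k`-periodic
function `f : ℤ → ℤ × ℤ` (so `W_i = f i`), with adjacency and no turning back. -/
def IsClosedWalk (k : ℕ) (f : ℤ → ℤ × ℤ) : Prop :=
  0 < k ∧ (∀ i : ℤ, f (i + (k : ℤ)) = f i) ∧ (∀ i : ℤ, bwAdj (f i) (f (i + 1))) ∧
    (∀ i : ℤ, f (i - 1) ≠ f (i + 1))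

/-- The neighbor of `v` immediately following `u` in the clockwise order
around `v` in the planar drawing of the brickwall:
around `b_{i,j}` with `i` odd the clockwise order is
`(b_{i+1,j+1}, b_{i+1,j}, b_{i-1,j})`, and with `i` even it is
`(b_{i+1,j}, b_{i-1,j-1}, b_{i-1,j})`. -/
def cwNext (v u : ℤ × ℤ) : ℤ × ℤ :=
  if v.1 % 2 = 0 then
    (if u = (v.1 + 1, v.2) then (v.1 - 1, v.2 - 1)
     else if u = (v.1 - 1, v.2 - 1) then (v.1 - 1, v.2)
     else (v.1 + 1, v.2))
  else
    (if u = (v.1 + 1, v.2 + 1) then (v.1 + 1, v.2)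
     else if u = (v.1 + 1, v.2) then (v.1 - 1, v.2)
     else (v.1 + 1, v.2 + 1))

/-- `W` makes a right turn at `i`: `W_{i-1}` immediately follows `W_{i+1}` clockwise. -/
def RightTurn (f : ℤ → ℤ × ℤ) (i : ℤ) : Prop := f (i - 1) = cwNext (f i) (f (i + 1))

/-- `W` makes a left turn at `i`: `W_{i+1}` immediately follows `W_{i-1}` clockwise. -/
def LeftTurn (f : ℤ → ℤ × ℤ) (i : ℤ) : Prop := f (i + 1) = cwNext (f i) (f (i - 1))

noncomputable def rightCount (k : ℕ) (f : ℤ → ℤ × ℤ) : ℕ :=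
  ((Finset.range k).filter fun t => RightTurn f (t : ℤ)).card

noncomputable def leftCount (k : ℕ) (f : ℤ → ℤ × ℤ) : ℕ :=
  ((Finset.range k).filter fun t => LeftTurn f (t : ℤ)).card

/-- The turning number `t(W) = (Right(W) - Left(W))/6`. -/
noncomputable def turningNumber (k : ℕ) (f : ℤ → ℤ × ℤ) : ℚ :=
  ((rightCount k f : ℚ) - (leftCount k f : ℚ)) / 6

/-- `uv` is a horizontal right edge: same height, smaller first coordinate even. -/
def HorizRight (u v : ℤ × ℤ) : Prop := u.2 = v.2 ∧ Even (min u.1 v.1)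

/-- `uv` is a horizontal left edge: same height, smaller first coordinate odd. -/
def HorizLeft (u v : ℤ × ℤ) : Prop := u.2 = v.2 ∧ Odd (min u.1 v.1)

/-- A right-turn walk: every vertical edge is immediately followed by a horizontal
right edge and immediately preceded by a horizontal left edge. -/
def IsRightTurnWalk (f : ℤ → ℤ × ℤ) : Prop :=
  ∀ i : ℤ, (f i).2 ≠ (f (i + 1)).2 →
    HorizRight (f (i + 1)) (f (i + 2)) ∧ HorizLeft (f (i - 1)) (f i)

/-- The unique neighbor of `W_i` other than `W_{i-1}` and `W_{i+1}`. -/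
def thirdNb (f : ℤ → ℤ × ℤ) (i : ℤ) : ℤ × ℤ :=
  if cwNext (f i) (f (i + 1)) = f (i - 1) then cwNext (f i) (f (i - 1))
  else cwNext (f i) (f (i + 1))

/-- `i ∈ {0,…,k-1}` is a PA-index: `W` makes a left turn at `i` and the third
neighbor of `W_i` has the same height as `W_i`. -/
def IsPAIndex (k : ℕ) (f : ℤ → ℤ × ℤ) (i : ℤ) : Prop :=
  0 ≤ i ∧ i < (k : ℤ) ∧ LeftTurn f i ∧ (thirdNb f i).2 = (f i).2

/-- The horizontal path in the brickwall from `u` to `v` (same height), as a list. -/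
def horizPath (u v : ℤ × ℤ) : List (ℤ × ℤ) :=
  if u.1 ≤ v.1 then (List.range ((v.1 - u.1).toNat + 1)).map fun t => (u.1 + (t : ℤ), u.2)
  else (List.range ((u.1 - v.1).toNat + 1)).map fun t => (u.1 - (t : ℤ), u.2)

/-- `p = {x,y}` is a possible assignment (PA) of the closed walk. -/
def IsPA (k : ℕ) (f : ℤ → ℤ × ℤ) (p : Finset ℤ) : Prop :=
  ∃ x y : ℤ, p = {x, y} ∧ IsPAIndex k f x ∧ IsPAIndex k f y ∧
    f x ≠ f y ∧ (f x).2 = (f y).2 ∧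
    ∀ z ∈ horizPath (f x) (f y),
      z ≠ f (x - 1) ∧ z ≠ f (x + 1) ∧ z ≠ f (y - 1) ∧ z ≠ f (y + 1)

/-- A proper assignment set: a set of PAs forming a non-crossing perfect matching
on the PA-indices. -/
def IsProperAssignment (k : ℕ) (f : ℤ → ℤ × ℤ) (A : Set (Finset ℤ)) : Prop :=
  (∀ p ∈ A, IsPA k f p) ∧
  (∀ i : ℤ, IsPAIndex k f i → ∃! p, p ∈ A ∧ i ∈ p) ∧
  (∀ p ∈ A, ∀ q ∈ A, ∀ i ∈ p, ∀ j ∈ p, ∀ x ∈ q, ∀ y ∈ q, ¬(i < x ∧ x < j ∧ j < y))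

/-- `n(i)`: the first PA-index strictly after `i` in cyclic order
(minimizing the cyclic distance `((j - i - 1) mod k) + 1`). -/
noncomputable def nextPA (k : ℕ) (f : ℤ → ℤ × ℤ) (i : ℤ) : ℤ :=
  if h : ∃ j : ℤ, IsPAIndex k f j ∧ ∀ j' : ℤ, IsPAIndex k f j' →
      (j - i - 1) % (k : ℤ) ≤ (j' - i - 1) % (k : ℤ)
  then h.choose else 0

/-- The subwalk `W_{x,y}` of the closed walk, as a list of `((y-x) mod k) + 1` vertices. -/
def subwalkList (k : ℕ) (f : ℤ → ℤ × ℤ) (x y : ℤ) : List (ℤ × ℤ) :=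
  (List.range (((y - x) % (k : ℤ)).toNat + 1)).map fun t => f (x + (t : ℤ))

/-- The cyclic function `ℤ → ℤ × ℤ` determined by a list of vertices. -/
def listFun (L : List (ℤ × ℤ)) : ℤ → ℤ × ℤ :=
  fun z => L.getD ((z % (L.length : ℤ)).toNat) (0, 0)

/-- An elementary cycle of `(W, A)`, given by its index sequence
`i_0, …, i_l` of PA-indices with `{n(i_t), i_{t+1}} ∈ A`, `{n(i_l), i_0} ∈ A`,
and canonical rotation `i_0 < i_t` for `t ≥ 1`. -/
structure ElemCycle (k : ℕ) (f : ℤ → ℤ × ℤ) (A : Set (Finset ℤ)) where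
  l : ℕ
  idx : ℕ → ℤ
  pa : ∀ t : ℕ, t ≤ l → IsPAIndex k f (idx t)
  mem : ∀ t : ℕ, t < l → ({nextPA k f (idx t), idx (t + 1)} : Finset ℤ) ∈ A
  memLast : ({nextPA k f (idx l), idx 0} : Finset ℤ) ∈ A
  minimal : ∀ t : ℕ, 1 ≤ t → t ≤ l → idx 0 < idx t
  canon : ∀ t : ℕ, l < t → idx t = idx 0

/-- The `t`-th segment `W_{i_t, n(i_t)} ∘ H_{n(i_t), i_{t+1}}` of an elementary
cycle (with final vertex dropped, for concatenation). -/
noncomputable def ecSegment {k : ℕ} {f : ℤ → ℤ × ℤ} {A : Set (Finset ℤ)}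
    (E : ElemCycle k f A) (t : ℕ) : List (ℤ × ℤ) :=
  (subwalkList k f (E.idx t) (nextPA k f (E.idx t))).dropLast ++
  (horizPath (f (nextPA k f (E.idx t))) (f (E.idx (if t = E.l then 0 else t + 1)))).dropLast

/-- The closed walk `C = W_{i_0,n(i_0)} ∘ H_{n(i_0),i_1} ∘ ⋯ ∘ H_{n(i_l),i_0}` of an
elementary cycle, as a list (without the repeated final vertex). -/
noncomputable def ecOpenList {k : ℕ} {f : ℤ → ℤ × ℤ} {A : Set (Finset ℤ)}
    (E : ElemCycle k f A) : List (ℤ × ℤ) :=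
  (List.range (E.l + 1)).flatMap (ecSegment E)

/-- The length of the closed walk of an elementary cycle. -/
noncomputable def ecLen {k : ℕ} {f : ℤ → ℤ × ℤ} {A : Set (Finset ℤ)}
    (E : ElemCycle k f A) : ℕ := (ecOpenList E).length

/-- The closed walk of an elementary cycle, as a periodic function. -/
noncomputable def ecFun {k : ℕ} {f : ℤ → ℤ × ℤ} {A : Set (Finset ℤ)}
    (E : ElemCycle k f A) : ℤ → ℤ × ℤ := listFun (ecOpenList E)

/-- `(m, g)` is (the closed walk of) an elementary cycle of `(W, A)`; if `A = ∅`
and `W` has no PA-index, `W` itself is the unique elementary cycle. -/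
def IsElemCycleWalk (k : ℕ) (f : ℤ → ℤ × ℤ) (A : Set (Finset ℤ))
    (m : ℕ) (g : ℤ → ℤ × ℤ) : Prop :=
  (∃ E : ElemCycle k f A, m = ecLen E ∧ g = ecFun E) ∨
  (A = ∅ ∧ (∀ i : ℤ, ¬ IsPAIndex k f i) ∧ m = k ∧ g = f)

/-- The number of elementary cycles of `(W, A)` (elementary cycles being
identified with their index sequences). -/
noncomputable def numElemCycles (k : ℕ) (f : ℤ → ℤ × ℤ) (A : Set (Finset ℤ)) : ℕ :=
  if A = ∅ ∧ ∀ i : ℤ, ¬ IsPAIndex k f i then 1 else Nat.card (ElemCycle k f A)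

/-- The number of PA-indices of the closed walk. -/
noncomputable def paCount (k : ℕ) (f : ℤ → ℤ × ℤ) : ℕ :=
  Nat.card {i : ℤ // IsPAIndex k f i}

/-- The walk `W' = W_{0,y} ∘ H_{y,0}`, as a list (without repeated final vertex). -/
noncomputable def splitList (k : ℕ) (f : ℤ → ℤ × ℤ) (y : ℤ) : List (ℤ × ℤ) :=
  (subwalkList k f 0 y).dropLast ++ (horizPath (f y) (f 0)).dropLast

/-- The length of the walk `W' = W_{0,y} ∘ H_{y,0}`. -/
noncomputable def splitLen (k : ℕ) (f : ℤ → ℤ × ℤ) (y : ℤ) : ℕ := (splitList k f y).length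

/-- The walk `W' = W_{0,y} ∘ H_{y,0}`, as a periodic function. -/
noncomputable def splitFun (k : ℕ) (f : ℤ → ℤ × ℤ) (y : ℤ) : ℤ → ℤ × ℤ :=
  listFun (splitList k f y)

/-- `Σ_{C ∈ 𝒞} (t(C) - 1)` over the set `𝒞` of elementary cycles of `(W, A)`. -/
noncomputable def elemTurnSum (k : ℕ) (f : ℤ → ℤ × ℤ) (A : Set (Finset ℤ)) : ℚ :=
  if A = ∅ ∧ ∀ i : ℤ, ¬ IsPAIndex k f i then turningNumber k f - 1
  else ∑ᶠ E : ElemCycle k f A, (turningNumber (ecLen E) (ecFun E) - 1)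

/-- The points of `P` that are least in their forward orbit under `σ`. -/
def cycleMinima {α : Type*} [LinearOrder α] (P : Set α) (σ : α → α) : Set α :=
  {i ∈ P | ∀ t : ℕ, i ≤ σ^[t] i}

/-- The points of `P` that are greatest in their forward orbit under `σ`. -/
def cycleMaxima {α : Type*} [LinearOrder α] (P : Set α) (σ : α → α) : Set α :=
  {i ∈ P | ∀ t : ℕ, σ^[t] i ≤ i}

theorem exists_isPeriodicPt_of_injOn {α : Type*} {P : Set α} {σ : α → α} (hP : P.Finite)
    (hmap : Set.MapsTo σ P P) (hinj : Set.InjOn σ P) {i : α} (hi : i ∈ P) :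
    ∃ n, 0 < n ∧ Function.IsPeriodicPt σ n i := by
  have : Finite P := hP
  have hrestr : Function.Injective (hmap.restrict σ P P) := hmap.restrict_inj.2 hinj
  obtain ⟨n, hn, hper⟩ := hrestr.mem_periodicPts ⟨i, hi⟩
  refine ⟨n, hn, ?_⟩
  have h := congrArg Subtype.val hper
  rwa [hmap.iterate_restrict] at h

theorem exists_iterate_return {α : Type*} {σ : α → α} {i : α} {n : ℕ} (hn : 0 < n)
    (hper : Function.IsPeriodicPt σ n i) (t : ℕ) : ∃ s, σ^[s] (σ^[t] i) = i := by
  obtain ⟨m, rfl⟩ : ∃ m, n = m + 1 := ⟨n - 1, by omega⟩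
  refine ⟨m * t, ?_⟩
  rw [← Function.iterate_add_apply]
  have h := hper.mul_const t
  rwa [show m * t + t = (m + 1) * t by ring]

theorem ncard_cycleMinima_le {α : Type*} [LinearOrder α] {P : Set α} {σ : α → α}
    (hP : P.Finite) (hmap : Set.MapsTo σ P P)
    (hper : ∀ i ∈ P, ∃ n, 0 < n ∧ Function.IsPeriodicPt σ n i) :
    (cycleMinima P σ).ncard ≤ (cycleMaxima P σ).ncard := by
  have hmax : ∀ i ∈ P, ∃ m ∈ cycleMaxima P σ, ∃ t, σ^[t] i = m := by
    intro i hi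
    have hsub : Set.range (fun t => σ^[t] i) ⊆ P := by
      rintro _ ⟨t, rfl⟩
      exact hmap.iterate t hi
    obtain ⟨_, ⟨t, rfl⟩, ht⟩ :=
      Set.exists_max_image _ id (hP.subset hsub) (Set.range_nonempty _)
    refine ⟨_, ⟨hmap.iterate t hi, fun s => ?_⟩, t, rfl⟩
    have := ht _ ⟨s + t, rfl⟩
    simpa [Function.iterate_add_apply] using this
  choose! m hm t ht using hmax
  refine Set.ncard_le_ncard_of_injOn m (fun i hi => hm i hi.1) ?_
    (hP.subset fun i hi => hi.1)
  have key : ∀ i ∈ cycleMinima P σ, ∀ j ∈ cycleMinima P σ, m i = m j → i ≤ j := by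
    intro i hi j hj hij
    obtain ⟨n, hn, hpn⟩ := hper j hj.1
    obtain ⟨s, hs⟩ := exists_iterate_return hn hpn (t j)
    have := hi.2 (s + t i)
    rwa [Function.iterate_add_apply, ht i hi.1, hij, ← ht j hj.1, hs] at this
  exact fun i hi j hj hij => le_antisymm (key i hi j hj hij) (key j hj i hi hij.symm)

theorem ncard_cycleMinima_eq {α : Type*} [LinearOrder α] {P : Set α} {σ : α → α}
    (hP : P.Finite) (hmap : Set.MapsTo σ P P)
    (hper : ∀ i ∈ P, ∃ n, 0 < n ∧ Function.IsPeriodicPt σ n i) :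
    (cycleMinima P σ).ncard = (cycleMaxima P σ).ncard :=
  le_antisymm (ncard_cycleMinima_le hP hmap hper)
    (ncard_cycleMinima_le (α := αᵒᵈ) hP hmap hper)

/-- If `σ` sends an index to the unique successor of it in an elementary cycle, then elementary
cycles correspond to the least elements of the cycles of `σ`. -/
theorem card_elemCycle {k : ℕ} {f : ℤ → ℤ × ℤ} {A : Set (Finset ℤ)} {σ : ℤ → ℤ}
    (hmap : Set.MapsTo σ {i | IsPAIndex k f i} {i | IsPAIndex k f i})
    (hσ : ∀ i, IsPAIndex k f i → ∀ j, ({nextPA k f i, j} : Finset ℤ) ∈ A ↔ j = σ i)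
    (hper : ∀ i, IsPAIndex k f i → ∃ n, 0 < n ∧ Function.IsPeriodicPt σ n i) :
    Nat.card (ElemCycle k f A) = (cycleMinima {i | IsPAIndex k f i} σ).ncard := by
  have hidx : ∀ E : ElemCycle k f A, ∀ t ≤ E.l, E.idx t = σ^[t] (E.idx 0) := by
    intro E t
    induction t with
    | zero => intro _; rfl
    | succ t ih =>
      intro ht
      rw [Function.iterate_succ_apply', ← ih (by omega)]
      exact (hσ _ (E.pa t (by omega)) _).1 (E.mem t (by omega))
  have hclose : ∀ E : ElemCycle k f A, Function.IsPeriodicPt σ (E.l + 1) (E.idx 0) := by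
    intro E
    show σ^[E.l + 1] (E.idx 0) = E.idx 0
    rw [Function.iterate_succ_apply', ← hidx E E.l le_rfl]
    exact ((hσ _ (E.pa _ le_rfl) _).1 E.memLast).symm
  have hmin : ∀ E : ElemCycle k f A, E.idx 0 ∈ cycleMinima {i | IsPAIndex k f i} σ := by
    refine fun E => ⟨E.pa 0 (Nat.zero_le _), fun t => ?_⟩
    rw [← (hclose E).iterate_mod_apply t]
    have hlt : t % (E.l + 1) < E.l + 1 := Nat.mod_lt t (Nat.succ_pos E.l)
    rw [← hidx E _ (by omega)]
    rcases Nat.eq_zero_or_pos (t % (E.l + 1)) with h | h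
    · rw [h]
    · exact (E.minimal _ h (by omega)).le
  have hle : ∀ E F : ElemCycle k f A, E.idx 0 = F.idx 0 → E.l ≤ F.l := by
    intro E F h
    by_contra! hlt
    have h1 := E.minimal (F.l + 1) (by omega) (by omega)
    rw [hidx E (F.l + 1) (by omega), h, (hclose F).eq] at h1
    exact lt_irrefl _ h1
  refine Nat.card_eq_of_bijective
    (fun E => (⟨E.idx 0, hmin E⟩ : cycleMinima {i | IsPAIndex k f i} σ)) ⟨?_, ?_⟩
  · intro E F h
    have h0 : E.idx 0 = F.idx 0 := congrArg Subtype.val h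
    have hl : E.l = F.l := le_antisymm (hle E F h0) (hle F E h0.symm)
    have hi : E.idx = F.idx := by
      funext t
      rcases le_or_gt t E.l with ht | ht
      · rw [hidx E t ht, hidx F t (hl ▸ ht), h0]
      · rw [E.canon t ht, F.canon t (hl ▸ ht), h0]
    cases E
    cases F
    cases hl
    cases hi
    rfl
  · rintro ⟨i, hi, hle_i⟩
    obtain ⟨n, hn, hpn⟩ := hper i hi
    have hpos := hpn.minimalPeriod_pos hn
    set q := Function.minimalPeriod σ i with hq
    have hpq : σ^[q] i = i := Function.isPeriodicPt_minimalPeriod σ i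
    refine ⟨⟨q - 1, fun t => if t ≤ q - 1 then σ^[t] i else i, ?_, ?_, ?_, ?_, ?_⟩, ?_⟩
    · intro t ht
      simpa [ht] using hmap.iterate t hi
    · intro t ht
      rw [if_pos (by omega), if_pos (by omega), hσ _ (hmap.iterate t hi),
        Function.iterate_succ_apply']
    · rw [if_pos le_rfl, if_pos (Nat.zero_le _), hσ _ (hmap.iterate _ hi),
        ← Function.iterate_succ_apply' σ, Nat.succ_eq_add_one, Nat.sub_add_cancel hpos, hpq]
      rfl
    · intro t ht htq
      rw [if_pos (Nat.zero_le _), if_pos htq]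
      refine lt_of_le_of_ne (hle_i t) fun h => ?_
      have hpt : Function.IsPeriodicPt σ t i := h.symm
      have := hpt.minimalPeriod_le ht
      omega
    · intro t ht
      simp [not_le.2 ht]
    · simp

/-- `j` is the cyclic successor of `i` in the set of integers `P`. -/
def IsCyclicSucc (P : Set ℤ) (i j : ℤ) : Prop :=
  j ∈ P ∧ ((i < j ∧ ∀ m ∈ P, i < m → j ≤ m) ∨ ∀ m ∈ P, m ≤ i ∧ j ≤ m)

theorem IsCyclicSucc.unique {P : Set ℤ} {i j m : ℤ} (hj : IsCyclicSucc P i j)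
    (hm : IsCyclicSucc P i m) : j = m := by
  obtain ⟨hjP, hj⟩ := hj
  obtain ⟨hmP, hm⟩ := hm
  grind

theorem IsCyclicSucc.injective {P : Set ℤ} {i j m : ℤ} (hi : i ∈ P) (hj : j ∈ P)
    (him : IsCyclicSucc P i m) (hjm : IsCyclicSucc P j m) : i = j := by
  obtain ⟨-, him⟩ := him
  obtain ⟨hmP, hjm⟩ := hjm
  grind

theorem finite_isPAIndex (k : ℕ) (f : ℤ → ℤ × ℤ) : {i | IsPAIndex k f i}.Finite :=
  (Set.finite_Ico (0 : ℤ) k).subset fun _ hi => ⟨hi.1, hi.2.1⟩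

theorem sub_sub_one_emod {k i j : ℤ} (hi : 0 ≤ i) (hik : i < k) (hj : 0 ≤ j) (hjk : j < k) :
    (j - i - 1) % k = if i < j then j - i - 1 else j - i - 1 + k := by
  split_ifs with h
  · exact Int.emod_eq_of_lt (by omega) (by omega)
  · rw [← Int.add_emod_right]
    exact Int.emod_eq_of_lt (by omega) (by omega)

theorem isCyclicSucc_nextPA {k : ℕ} {f : ℤ → ℤ × ℤ} {i : ℤ} (hi : IsPAIndex k f i) :
    IsCyclicSucc {i | IsPAIndex k f i} i (nextPA k f i) := by
  have hex : ∃ j : ℤ, IsPAIndex k f j ∧ ∀ j' : ℤ, IsPAIndex k f j' →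
      (j - i - 1) % (k : ℤ) ≤ (j' - i - 1) % (k : ℤ) :=
    Set.exists_min_image {i | IsPAIndex k f i} (fun j => (j - i - 1) % (k : ℤ))
      (finite_isPAIndex k f) ⟨i, hi⟩
  obtain ⟨hn, hle⟩ : IsPAIndex k f (nextPA k f i) ∧ ∀ j' : ℤ, IsPAIndex k f j' →
      (nextPA k f i - i - 1) % (k : ℤ) ≤ (j' - i - 1) % (k : ℤ) := by
    rw [nextPA, dif_pos hex]
    exact hex.choose_spec
  refine ⟨hn, ?_⟩
  have hcmp : ∀ j, IsPAIndex k f j → 0 ≤ j ∧ j < (k : ℤ) ∧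
      (if i < nextPA k f i then nextPA k f i - i - 1 else nextPA k f i - i - 1 + k) ≤
        (if i < j then j - i - 1 else j - i - 1 + (k : ℤ)) := by
    intro j hj
    have h := hle j hj
    rw [sub_sub_one_emod hi.1 hi.2.1 hn.1 hn.2.1, sub_sub_one_emod hi.1 hi.2.1 hj.1 hj.2.1] at h
    exact ⟨hj.1, hj.2.1, h⟩
  have hn0 := hn.1
  by_cases hlt : i < nextPA k f i
  · refine Or.inl ⟨hlt, fun m hm him => ?_⟩
    have h := (hcmp m hm).2.2
    rw [if_pos hlt, if_pos him] at h
    omega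
  · refine Or.inr fun m hm => ?_
    have h := hcmp m hm
    rw [if_neg hlt] at h
    split_ifs at h <;> omega

theorem bwAdj_symm {u v : ℤ × ℤ} (h : bwAdj u v) : bwAdj v u := by
  unfold bwAdj at *
  grind

theorem cwNext_injOn (v : ℤ × ℤ) : Set.InjOn (cwNext v) {u | bwAdj v u} := by
  obtain ⟨a, b⟩ := v
  rintro ⟨c, d⟩ h ⟨c', d'⟩ h' heq
  simp only [Set.mem_ofPred_eq, bwAdj, cwNext, Int.odd_iff, Prod.mk.injEq] at *
  split_ifs at heq <;> simp only [Prod.mk.injEq] at heq <;> omega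

/-- A walk going straight along a row has no PA-index there. -/
theorem not_isPAIndex_of_horizontal {k : ℕ} {g : ℤ → ℤ × ℤ} {i a b s : ℤ} (hs : s = 1 ∨ s = -1)
    (hprev : g (i - 1) = (a - s, b)) (hcur : g i = (a, b)) (hnext : g (i + 1) = (a + s, b)) :
    ¬ IsPAIndex k g i := by
  rintro ⟨-, -, -, h⟩
  revert h
  simp only [thirdNb, hprev, hcur, hnext, cwNext]
  grind

theorem map_natCast_range {β : Type*} (g : ℤ → β) (n : ℕ) :
    (do let t ← List.range n; pure (t : ℤ)).map g = (List.range n).map fun t : ℕ => g t := by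
  simp [List.map_eq_flatMap, List.flatMap_assoc]

theorem horizPath_eq {u v : ℤ × ℤ} (huv : u.1 ≠ v.1) :
    ∃ (s : ℤ) (d : ℕ), (s = 1 ∨ s = -1) ∧ 0 < d ∧ v.1 = u.1 + s * d ∧
      horizPath u v = (List.range (d + 1)).map fun t : ℕ => (u.1 + s * (t : ℤ), u.2) := by
  simp only [horizPath, map_natCast_range]
  rcases lt_or_gt_of_ne huv with h | h
  · refine ⟨1, (v.1 - u.1).toNat, Or.inl rfl, by omega, by omega, ?_⟩
    rw [if_pos h.le]
    simp
  · refine ⟨-1, (u.1 - v.1).toNat, Or.inr rfl, by omega, by omega, ?_⟩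
    rw [if_neg (by omega)]
    simp [sub_eq_add_neg]

theorem mem_horizPath_of_le {u v : ℤ × ℤ} {x : ℤ}
    (hx : (u.1 ≤ x ∧ x ≤ v.1) ∨ (v.1 ≤ x ∧ x ≤ u.1)) : (x, u.2) ∈ horizPath u v := by
  simp only [horizPath, map_natCast_range]
  split_ifs with h
  · refine List.mem_map.2 ⟨(x - u.1).toNat, List.mem_range.2 (by omega), ?_⟩
    ext <;> simp
    omega
  · refine List.mem_map.2 ⟨(u.1 - x).toNat, List.mem_range.2 (by omega), ?_⟩
    ext <;> simp
    omega

theorem dropLast_map_range {β : Type*} (g : ℕ → β) (n : ℕ) :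
    ((List.range (n + 1)).map g).dropLast = (List.range n).map g := by
  simp [List.range_succ]

/-- The split walk follows `f` up to the index `y` and then goes straight along the row of
`f y` until it closes up at `f 0`. -/
theorem splitFun_spec {k : ℕ} {f : ℤ → ℤ × ℤ} {y : ℤ} (hy0 : 0 < y) (hyk : y < k)
    (hne : f y ≠ f 0) (hheight : (f y).2 = (f 0).2) :
    ∃ s d : ℤ, (s = 1 ∨ s = -1) ∧ 0 < d ∧ f 0 = ((f y).1 + s * d, (f y).2) ∧
      (splitLen k f y : ℤ) = y + d ∧
      (∀ i, 0 ≤ i → i < y → splitFun k f y i = f i) ∧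
      (∀ i, y ≤ i → i ≤ y + d → splitFun k f y i = ((f y).1 + s * (i - y), (f y).2)) ∧
      splitFun k f y (-1) = ((f 0).1 - s, (f 0).2) := by
  obtain ⟨s, d, hs, hd, hv, hpath⟩ :=
    horizPath_eq (u := f y) (v := f 0) fun h => hne (Prod.ext h hheight)
  have hL : splitList k f y = (List.range y.toNat).map (fun t : ℕ => f (t : ℤ)) ++
      (List.range d).map fun t : ℕ => ((f y).1 + s * (t : ℤ), (f y).2) := by
    rw [splitList, subwalkList, map_natCast_range, hpath, dropLast_map_range, dropLast_map_range, sub_zero,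
      Int.emod_eq_of_lt hy0.le hyk]
    simp
  have hlen : (splitList k f y).length = y.toNat + d := by simp [hL]
  have hf0 : f 0 = ((f y).1 + s * d, (f y).2) := Prod.ext hv hheight.symm
  have hval : ∀ i, 0 ≤ i → i < y + d →
      splitFun k f y i = (splitList k f y).getD i.toNat (0, 0) := by
    intro i hi hid
    rw [splitFun, listFun, hlen, Int.emod_eq_of_lt hi (by omega)]
  have hwalk : ∀ i, 0 ≤ i → i < y → splitFun k f y i = f i := by
    intro i hi hiy
    rw [hval i hi (by omega), hL, List.getD_append _ _ _ _ (by simp; omega)]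
    rw [List.getD_eq_getElem _ _ (by simp; omega)]
    simp [hi]
  have hrow : ∀ i, y ≤ i → i < y + d → splitFun k f y i = ((f y).1 + s * (i - y), (f y).2) := by
    intro i hi hid
    rw [hval i (by omega) hid, hL, List.getD_append_right _ _ _ _ (by simp; omega)]
    rw [List.getD_eq_getElem _ _ (by simp; omega)]
    simp
    left
    omega
  refine ⟨s, d, hs, by omega, hf0, by rw [splitLen, hlen]; push_cast; omega, hwalk, ?_, ?_⟩
  · intro i hi hid
    rcases hid.lt_or_eq with h | rfl
    · exact hrow i hi h
    · have hper : splitFun k f y (y + d) = splitFun k f y 0 := by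
        simp only [splitFun, listFun, hlen]
        rw [show (y + d : ℤ) = ((y.toNat + d : ℕ) : ℤ) by push_cast; omega]
        simp
      rw [hper, hwalk 0 le_rfl hy0, hf0]
      simp
  · have hper : splitFun k f y (-1) = splitFun k f y (y + d - 1) := by
      simp only [splitFun, listFun, hlen]
      rw [← Int.add_emod_right]
      congr 3
      push_cast
      omega
    rw [hper, hrow _ (by omega) (by omega), hf0]
    ext
    · simp only
      ring
    · rfl

theorem isPAIndex_split_iff {k : ℕ} {f : ℤ → ℤ × ℤ} {y : ℤ} (hW : IsClosedWalk k f)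
    (hy0 : 0 < y) (hpa0 : IsPAIndex k f 0) (hpay : IsPAIndex k f y)
    (hlast : ∀ i, IsPAIndex k f i → i ≤ y)
    (hne : f y ≠ f 0) (hheight : (f y).2 = (f 0).2)
    (havoid : ∀ x, ((f y).1 ≤ x ∧ x ≤ (f 0).1) ∨ ((f 0).1 ≤ x ∧ x ≤ (f y).1) →
      (x, (f y).2) ≠ f (-1) ∧ (x, (f y).2) ≠ f (y + 1)) (i : ℤ) :
    IsPAIndex (splitLen k f y) (splitFun k f y) i ↔ IsPAIndex k f i ∧ i ≠ 0 ∧ i ≠ y := by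
  obtain ⟨s, d, hs, hd, hf0, hlen, hwalk, hrow, hneg⟩ := splitFun_spec hy0 hpay.2.1 hne hheight
  obtain ⟨-, -, hadj, -⟩ := hW
  have hfy : splitFun k f y y = f y := by
    rw [hrow y le_rfl (by omega)]
    ext <;> simp
  have hwalk' : ∀ i, 0 ≤ i → i ≤ y → splitFun k f y i = f i := by
    intro i hi hiy
    rcases hiy.lt_or_eq with h | rfl
    · exact hwalk i hi h
    · exact hfy
  have hinner : 0 < i → i < y → (IsPAIndex (splitLen k f y) (splitFun k f y) i ↔
      IsPAIndex k f i) := by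
    intro h0 h1
    have hyk := hpay.2.1
    unfold IsPAIndex LeftTurn thirdNb
    rw [hwalk' (i - 1) (by omega) (by omega), hwalk' i (by omega) (by omega),
      hwalk' (i + 1) (by omega) (by omega), hlen]
    constructor <;> rintro ⟨ha, hb, h⟩ <;> exact ⟨ha, by omega, h⟩
  have hf01 : (f 0).1 = (f y).1 + s * d := by rw [hf0]
  constructor
  · intro h
    have hi0 : i ≠ 0 := by
      rintro rfl
      have hturn := h.2.2.1
      have hturn' := hpa0.2.2.1
      simp only [LeftTurn, zero_sub, zero_add] at hturn hturn'
      rw [hneg, hwalk' 0 le_rfl hy0.le, hwalk' 1 (by omega) (by omega), hturn'] at hturn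
      have hadj' : bwAdj (f (-1)) (f 0) := by simpa using hadj (-1)
      have hrowadj : bwAdj (f 0) ((f 0).1 - s, (f 0).2) := by
        unfold bwAdj
        left
        refine ⟨rfl, ?_⟩
        simp only
        omega
      have heq := cwNext_injOn (f 0) (bwAdj_symm hadj') hrowadj hturn
      refine (havoid ((f 0).1 - s) ?_).1 ?_
      · rcases hs with rfl | rfl <;> omega
      · rw [heq, hheight]
    have hiy : i ≠ y := by
      rintro rfl
      have hturn := h.2.2.1
      have hturn' := hpay.2.2.1
      unfold LeftTurn at hturn hturn'
      rw [hfy, hwalk' (i - 1) (by omega) (by omega), ← hturn',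
        hrow (i + 1) (by omega) (by omega)] at hturn
      refine (havoid _ ?_).2 hturn
      rcases hs with rfl | rfl <;> omega
    refine ⟨?_, hi0, hiy⟩
    have h0 := h.1
    have h1 := h.2.1
    rcases lt_or_gt_of_ne hiy with hlt | hgt
    · exact (hinner (by omega) hlt).1 h
    · exfalso
      refine not_isPAIndex_of_horizontal (k := splitLen k f y) hs (a := (f y).1 + s * (i - y))
        (b := (f y).2) ?_ ?_ ?_ h
      · rw [hrow (i - 1) (by omega) (by omega)]
        ext
        · simp only
          ring
        · rfl
      · exact hrow i hgt.le (by omega)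
      · rw [hrow (i + 1) (by omega) (by omega)]
        ext
        · simp only
          ring
        · rfl
  · rintro ⟨h, hi0, hiy⟩
    have h0 := h.1
    have h1 := hlast i h
    exact (hinner (by omega) (by omega)).2 h

/-- If `A` is given by an involution `p` of the PA-indices, then elementary cycles correspond to
the greatest elements of the cycles of `p ∘ n`. -/
theorem card_elemCycle_eq_ncard_cycleMaxima {k : ℕ} {f : ℤ → ℤ × ℤ} {A : Set (Finset ℤ)}
    {p : ℤ → ℤ} (hp : ∀ i, IsPAIndex k f i → IsPAIndex k f (p i) ∧ p (p i) = i ∧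
      ∀ j, ({i, j} : Finset ℤ) ∈ A ↔ j = p i) :
    Nat.card (ElemCycle k f A) =
      (cycleMaxima {i | IsPAIndex k f i} fun i => p (nextPA k f i)).ncard := by
  have hnext : ∀ i, IsPAIndex k f i → IsPAIndex k f (nextPA k f i) :=
    fun i hi => (isCyclicSucc_nextPA hi).1
  have hmap : Set.MapsTo (fun i => p (nextPA k f i)) {i | IsPAIndex k f i}
      {i | IsPAIndex k f i} := fun i hi => (hp _ (hnext i hi)).1
  have hinj : Set.InjOn (fun i => p (nextPA k f i)) {i | IsPAIndex k f i} := by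
    intro i hi j hj hij
    have h := congrArg p hij
    simp only at h
    rw [(hp _ (hnext i hi)).2.1, (hp _ (hnext j hj)).2.1] at h
    exact (isCyclicSucc_nextPA hi).injective hi hj (h ▸ isCyclicSucc_nextPA hj)
  have hper := fun i hi =>
    exists_isPeriodicPt_of_injOn (i := i) (finite_isPAIndex k f) hmap hinj hi
  rw [card_elemCycle hmap (fun i hi j => (hp _ (hnext i hi)).2.2 j) hper,
    ncard_cycleMinima_eq (finite_isPAIndex k f) hmap hper]

/-- Bypassing the point `z` in the cycles of `σ` does not change which of the points above `z`
are greatest in their cycle. -/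
theorem forall_iterate_le_iff_of_bypass {α : Type*} [LinearOrder α] {Q : Set α} {σ τ : α → α}
    {z i : α} (hz : ∀ j ∈ Q, z ≤ j) (hmap : Set.MapsTo τ Q Q)
    (hstep : ∀ j ∈ Q, σ j = τ j ∨ (σ j = z ∧ σ z = τ j)) (hi : i ∈ Q) :
    (∀ t : ℕ, σ^[t] i ≤ i) ↔ ∀ t : ℕ, τ^[t] i ≤ i := by
  constructor
  · intro h t
    have horbit : ∃ s, σ^[s] i = τ^[t] i := by
      induction t with
      | zero => exact ⟨0, rfl⟩
      | succ t ih =>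
        obtain ⟨s, hs⟩ := ih
        rcases hstep _ (hmap.iterate t hi) with h | ⟨h, h'⟩
        · exact ⟨s + 1, by rw [Function.iterate_succ_apply', hs, h, Function.iterate_succ_apply']⟩
        · exact ⟨s + 2, by rw [Function.iterate_succ_apply', Function.iterate_succ_apply', hs, h,
            h', Function.iterate_succ_apply']⟩
    obtain ⟨s, hs⟩ := horbit
    exact hs ▸ h s
  · intro h t
    have horbit : ∃ s, σ^[t] i = τ^[s] i ∨ (σ^[t] i = z ∧ σ z = τ^[s] i) := by
      induction t with
      | zero => exact ⟨0, Or.inl rfl⟩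
      | succ t ih =>
        obtain ⟨s, hs | ⟨hs, hs'⟩⟩ := ih
        · refine ⟨s + 1, ?_⟩
          rw [Function.iterate_succ_apply', Function.iterate_succ_apply', hs]
          exact hstep _ (hmap.iterate s hi)
        · exact ⟨s, Or.inl (by rw [Function.iterate_succ_apply', hs, hs'])⟩
    obtain ⟨s, hs | ⟨hs, -⟩⟩ := horbit
    · exact hs ▸ h s
    · exact hs ▸ hz i hi

theorem IsProperAssignment.exists_partner {k : ℕ} {f : ℤ → ℤ × ℤ} {A : Set (Finset ℤ)}
    (hA : IsProperAssignment k f A) : ∃ p : ℤ → ℤ, ∀ i, IsPAIndex k f i →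
      IsPAIndex k f (p i) ∧ p (p i) = i ∧ ∀ j, ({i, j} : Finset ℤ) ∈ A ↔ j = p i := by
  have hex : ∀ i, IsPAIndex k f i →
      ∃ j, IsPAIndex k f j ∧ ∀ m, ({i, m} : Finset ℤ) ∈ A ↔ m = j := by
    intro i hi
    obtain ⟨q, ⟨hqA, hiq⟩, huniq⟩ := hA.2.1 i hi
    obtain ⟨x, z, rfl, hx, hz, hne, -⟩ := hA.1 q hqA
    have hxz : x ≠ z := fun h => hne (h ▸ rfl)
    have key : ∀ j, ({x, z} : Finset ℤ) = {i, j} → i ≠ j →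
        ∀ m, ({i, m} : Finset ℤ) ∈ A ↔ m = j := by
      intro j hj hij m
      constructor
      · intro hm
        have h := (huniq _ ⟨hm, by simp⟩).trans hj
        have hmem : j ∈ ({i, m} : Finset ℤ) := by rw [h]; simp
        simp only [Finset.mem_insert, Finset.mem_singleton] at hmem
        exact (hmem.resolve_left hij.symm).symm
      · rintro rfl
        exact hj ▸ hqA
    rcases Finset.mem_insert.1 hiq with rfl | h
    · exact ⟨z, hz, key z rfl hxz⟩
    · obtain rfl := Finset.mem_singleton.1 h
      exact ⟨x, hx, key x (Finset.pair_comm _ _) hxz.symm⟩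
  choose! p hp using hex
  refine ⟨p, fun i hi => ⟨(hp i hi).1, ?_, (hp i hi).2⟩⟩
  have h := ((hp i hi).2 (p i)).2 rfl
  rw [Finset.pair_comm] at h
  exact (((hp _ (hp i hi).1).2 i).1 h).symm

theorem IsPA.pair_facts {k : ℕ} {f : ℤ → ℤ × ℤ} {y : ℤ} (h : IsPA k f {0, y}) :
    IsPAIndex k f 0 ∧ IsPAIndex k f y ∧ f y ≠ f 0 ∧ (f y).2 = (f 0).2 ∧
      ∀ x, ((f y).1 ≤ x ∧ x ≤ (f 0).1) ∨ ((f 0).1 ≤ x ∧ x ≤ (f y).1) →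
        (x, (f y).2) ≠ f (-1) ∧ (x, (f y).2) ≠ f (y + 1) := by
  obtain ⟨a, b, hab, ha, hb, hne, hheight, havoid⟩ := h
  have hcases : (a = 0 ∧ b = y) ∨ (a = y ∧ b = 0) := by
    have hne' : a ≠ b := fun h => hne (h ▸ rfl)
    have h1 : a ∈ ({0, y} : Finset ℤ) := by rw [hab]; simp
    have h2 : b ∈ ({0, y} : Finset ℤ) := by rw [hab]; simp
    simp only [Finset.mem_insert, Finset.mem_singleton] at h1 h2
    grind
  rcases hcases with ⟨rfl, rfl⟩ | ⟨rfl, rfl⟩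
  · refine ⟨ha, hb, hne.symm, hheight.symm, fun x hx => ?_⟩
    have h := havoid _ (mem_horizPath_of_le (u := f 0) (v := f b) (x := x) hx.symm)
    rw [hheight] at h
    exact ⟨by simpa using h.1, h.2.2.2⟩
  · refine ⟨hb, ha, hne, hheight, fun x hx => ?_⟩
    have h := havoid _ (mem_horizPath_of_le (u := f a) (v := f 0) (x := x) hx)
    exact ⟨by simpa using h.2.2.1, h.2.1⟩

/-- Let `A` be a proper assignment set for a closed walk `W` in the
brickwall with `{0, y} ∈ A` and `n(y) = 0`, and let `W' = W_{0,y} ∘ H_{y,0}` and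
`A' = A \ {{0,y}}`. Then `(W, A)` has exactly one more elementary cycle than `(W', A')`. -/
theorem numElemCycles_split
    (k : ℕ) (f : ℤ → ℤ × ℤ) (A : Set (Finset ℤ)) (y : ℤ)
    (hW : IsClosedWalk k f) (hA : IsProperAssignment k f A)
    (hmem : ({0, y} : Finset ℤ) ∈ A) (hny : nextPA k f y = 0) :
    numElemCycles k f A =
      numElemCycles (splitLen k f y) (splitFun k f y)
        (A \ {({0, y} : Finset ℤ)}) + 1 := by
  obtain ⟨hpa0, hpay, hne, hheight, havoid⟩ := (hA.1 _ hmem).pair_facts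
  have hy0 : 0 < y := lt_of_le_of_ne hpay.1 fun h => hne (h ▸ rfl)
  have hsuccy := isCyclicSucc_nextPA hpay
  rw [hny] at hsuccy
  have hlast : ∀ i, IsPAIndex k f i → i ≤ y := by
    rcases hsuccy.2 with h | h
    · omega
    · exact fun i hi => (h i hi).1
  have hsplit := isPAIndex_split_iff hW hy0 hpa0 hpay hlast hne hheight havoid
  obtain ⟨p, hp⟩ := hA.exists_partner
  have hp0 : p 0 = y := (((hp 0 hpa0).2.2 y).1 hmem).symm
  have hpy : p y = 0 := hp0 ▸ (hp 0 hpa0).2.1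
  have hcount := card_elemCycle_eq_ncard_cycleMaxima hp
  have hAne : A ≠ ∅ := fun h => by simp [h] at hmem
  rw [numElemCycles, if_neg fun h => hAne h.1, hcount]
  set n := nextPA k f
  set σ : ℤ → ℤ := fun i => p (n i) with hσ
  have hσy : σ y = y := by simp only [hσ, hny, hp0]
  have hσy_iter : ∀ t : ℕ, σ^[t] y = y := Function.iterate_fixed hσy
  have hsucc0 : IsCyclicSucc {i | IsPAIndex k f i} 0 (n 0) := isCyclicSucc_nextPA hpa0
  have hnlt : ∀ i, IsPAIndex k f i → i < y →
      i < n i ∧ ∀ m, IsPAIndex k f m → i < m → n i ≤ m := by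
    intro i hi hiy
    rcases (isCyclicSucc_nextPA hi).2 with h | h
    · exact h
    · exact absurd (h y hpay).1 (by omega)
  by_cases hQ : ∃ i, IsPAIndex (splitLen k f y) (splitFun k f y) i
  · have hp' : ∀ i, IsPAIndex (splitLen k f y) (splitFun k f y) i →
        IsPAIndex (splitLen k f y) (splitFun k f y) (p i) ∧ p (p i) = i ∧
          ∀ j, ({i, j} : Finset ℤ) ∈ A \ {({0, y} : Finset ℤ)} ↔ j = p i := by
      intro i hi
      obtain ⟨hiP, hi0, hiy⟩ := (hsplit i).1 hi
      obtain ⟨h1, h2, h3⟩ := hp i hiP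
      refine ⟨(hsplit _).2 ⟨h1, fun h => hiy ?_, fun h => hi0 ?_⟩, h2, fun j => ?_⟩
      · rw [← h2, h, hp0]
      · rw [← h2, h, hpy]
      · rw [Set.mem_sdiff, h3, Set.mem_singleton_iff, and_iff_left]
        intro h
        have hmem_i : i ∈ ({0, y} : Finset ℤ) := by rw [← h]; simp
        simp only [Finset.mem_insert, Finset.mem_singleton] at hmem_i
        tauto
    obtain ⟨q, hq⟩ := hQ
    rw [numElemCycles, if_neg fun h => h.2 q hq, card_elemCycle_eq_ncard_cycleMaxima hp']
    set Q := {i | IsPAIndex (splitLen k f y) (splitFun k f y) i}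
    set n' := nextPA (splitLen k f y) (splitFun k f y)
    set τ : ℤ → ℤ := fun i => p (n' i) with hτ
    have hmemQ : ∀ i, i ∈ Q ↔ IsPAIndex k f i ∧ i ≠ 0 ∧ i ≠ y := hsplit
    have hstep : ∀ i ∈ Q, σ i = τ i ∨ (σ i = 0 ∧ σ 0 = τ i) := by
      intro i hi
      obtain ⟨hiP, hi0, hiy⟩ := (hmemQ i).1 hi
      have hsucc : IsCyclicSucc {i | IsPAIndex k f i} i (n i) := isCyclicSucc_nextPA hiP
      have hsucc' : IsCyclicSucc Q i (n' i) := isCyclicSucc_nextPA hi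
      have hily := hlast i hiP
      by_cases hni : n i = y
      · right
        have hn0 : n 0 ≠ y := fun h => hi0 <|
          hsucc.injective hiP hpa0 (by rw [hni, ← h]; exact hsucc0)
        have hn'i : n' i = n 0 := by
          refine hsucc'.unique ⟨(hmemQ _).2 ⟨hsucc0.1, ?_, hn0⟩, Or.inr fun m hm => ?_⟩
          · exact (hnlt 0 hpa0 hy0).1.ne'
          · obtain ⟨hmP, hm0, hmy⟩ := (hmemQ m).1 hm
            refine ⟨?_, (hnlt 0 hpa0 hy0).2 m hmP (lt_of_le_of_ne hmP.1 hm0.symm)⟩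
            by_contra! him
            have h1 := (hnlt i hiP (by omega)).2 m hmP him
            have h2 := hlast m hmP
            omega
        exact ⟨by simp only [hσ, hni, hpy], by simp only [hσ, hτ, hn'i]⟩
      · left
        have hni0 : n i ≠ 0 := fun h => hiy <|
          hsucc.injective hiP hpay (by rw [h]; exact hsuccy)
        have hn'i : n' i = n i := by
          refine hsucc'.unique ⟨(hmemQ _).2 ⟨hsucc.1, hni0, hni⟩, Or.inl ?_⟩
          have h := hnlt i hiP (by omega)
          exact ⟨h.1, fun m hm => h.2 m ((hmemQ m).1 hm).1⟩
        simp only [hσ, hτ, hn'i]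
    have hiff : ∀ i ∈ Q, (∀ t : ℕ, σ^[t] i ≤ i) ↔ ∀ t : ℕ, τ^[t] i ≤ i := fun i hi =>
      forall_iterate_le_iff_of_bypass (fun j hj => ((hmemQ j).1 hj).1.1)
        (fun j hj => (hp' _ (isCyclicSucc_nextPA hj).1).1) hstep hi
    have hzero : ¬ ∀ t : ℕ, σ^[t] 0 ≤ 0 := by
      intro h
      have h1 : σ 0 ≤ 0 := h 1
      have h2 := (hp _ hsucc0.1).1.1
      have h3 : p (n 0) = 0 := le_antisymm h1 h2
      have h4 : n 0 = y := by rw [← (hp _ hsucc0.1).2.1, h3, hp0]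
      obtain ⟨hqP, hq0, hqy⟩ := (hmemQ q).1 hq
      have h5 := (hnlt 0 hpa0 hy0).2 q hqP (lt_of_le_of_ne hqP.1 hq0.symm)
      have h6 := hlast q hqP
      omega
    have hset : cycleMaxima {i | IsPAIndex k f i} σ = insert y (cycleMaxima Q τ) := by
      ext i
      constructor
      · rintro ⟨hi, hmax⟩
        by_cases hiy : i = y
        · exact Or.inl hiy
        · have hiQ := (hmemQ i).2 ⟨hi, fun h => hzero (h ▸ hmax), hiy⟩
          exact Or.inr ⟨hiQ, (hiff i hiQ).1 hmax⟩
      · rintro (rfl | ⟨hi, hmax⟩)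
        · exact ⟨hpay, fun t => (hσy_iter t).le⟩
        · exact ⟨((hmemQ i).1 hi).1, (hiff i hi).2 hmax⟩
    rw [hset, Set.ncard_insert_of_notMem (fun h => ((hmemQ y).1 h.1).2.2 rfl)
      ((finite_isPAIndex _ _).subset fun i hi => hi.1)]
  · push Not at hQ
    have hP : ∀ i, IsPAIndex k f i → i = 0 ∨ i = y := by
      intro i hi
      by_contra! h
      exact hQ i ((hsplit i).2 ⟨hi, h⟩)
    have hA' : A \ {({0, y} : Finset ℤ)} = ∅ := by
      rw [Set.sdiff_eq_empty]
      intro q hq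
      obtain ⟨a, b, rfl, ha, hb, hab, -⟩ := hA.1 q hq
      have hab' : a ≠ b := fun h => hab (h ▸ rfl)
      rcases hP a ha with rfl | rfl <;> rcases hP b hb with rfl | rfl
      · exact absurd rfl hab'
      · rfl
      · exact Finset.pair_comm _ _
      · exact absurd rfl hab'
    rw [numElemCycles, if_pos ⟨hA', hQ⟩]
    have hn0 : n 0 = y :=
      (hP _ hsucc0.1).resolve_left (hnlt 0 hpa0 hy0).1.ne'
    have hσ0 : σ 0 = 0 := by simp only [hσ, hn0, hpy]
    have hset : cycleMaxima {i | IsPAIndex k f i} σ = {0, y} := by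
      ext i
      constructor
      · exact fun hi => hP i hi.1
      · rintro (rfl | rfl)
        · exact ⟨hpa0, fun t => (Function.iterate_fixed hσ0 t).le⟩
        · exact ⟨hpay, fun t => (hσy_iter t).le⟩
    rw [hset, Set.ncard_pair hy0.ne]

end Hex
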